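/- Let R be any ring with at least five elements. If Sink(R) is nonempty and finite, then every element of Sink(R) is strongly right invertible in R, and Γ(R) contains no source. -/

import Mathlib

variable {R : Type*} [NonUnitalRing R]

/-- `x` is a left zero-divisor. -/
def IsLeftZD (x : R) : Prop := ∃ y : R, y ≠ 0 ∧ x * y = 0

/-- `x` is a right zero-divisor. -/
def IsRightZD (x : R) : Prop := ∃ y : R, y ≠ 0 ∧ y * x = 0

/-- `x` is a vertex of the directed zero-divisor graph `Γ(R)`,
i.e. a nonzero (one-sided) zero-divisor. -/
def IsVertex (x : R) : Prop := x ≠ 0 ∧ (IsLeftZD x ∨ IsRightZD x)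

/-- Directed edge `x → y` of `Γ(R)`: distinct vertices with `x * y = 0`. -/
def Edge (x y : R) : Prop := IsVertex x ∧ IsVertex y ∧ x ≠ y ∧ x * y = 0

/-- A sink of `Γ(R)`: a vertex with positive in-degree and zero out-degree. -/
def IsSink (x : R) : Prop :=
  IsVertex x ∧ (∃ y : R, IsVertex y ∧ y ≠ x ∧ y * x = 0) ∧
    ¬ ∃ y : R, IsVertex y ∧ y ≠ x ∧ x * y = 0

/-- A source of `Γ(R)`: a vertex with positive out-degree and zero in-degree. -/
def IsSource (x : R) : Prop :=
  IsVertex x ∧ (∃ y : R, IsVertex y ∧ y ≠ x ∧ x * y = 0) ∧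
    ¬ ∃ y : R, IsVertex y ∧ y ≠ x ∧ y * x = 0

/-- `e` is a left identity of `R`. -/
def IsLeftId (e : R) : Prop := ∀ x : R, e * x = x

/-- `e` is a right identity of `R`. -/
def IsRightId (e : R) : Prop := ∀ x : R, x * e = x

/-- There is a directed path of length `n` from `x` to `y` in `Γ(R)`. -/
def HasPathLen (n : ℕ) (x y : R) : Prop :=
  ∃ f : ℕ → R, f 0 = x ∧ f n = y ∧ ∀ i < n, Edge (f i) (f (i + 1))

/-- `r` is strongly right invertible: `R` has a proper left identity and for
every left identity `e` there is a unique `s` with `r * s = e`. -/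
def StronglyRightInv (r : R) : Prop :=
  (∃ e : R, IsLeftId e ∧ ¬ IsRightId e) ∧
    ∀ e : R, IsLeftId e → ∃! s : R, r * s = e

theorem not_five_le_card_of_addMonoidHom {R : Type*} [AddCommGroup R] (f : R →+ R) (x : R)
    (hker : ∀ a, f a = 0 → a = 0 ∨ a = x) (hrange : ∀ a, f a = 0 ∨ f a = x) (s : Finset R) :
    ¬ 5 ≤ s.card := by
  classical
  have himage : (s.image f).card ≤ 2 := by
    refine (Finset.card_le_card (t := {0, x}) ?_).trans Finset.card_le_two
    intro b hb
    obtain ⟨a, -, rfl⟩ := Finset.mem_image.1 hb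
    simpa using hrange a
  have hfiber : s.card ≤ 2 * (s.image f).card := by
    refine Finset.card_le_mul_card_image s 2 fun b hb => ?_
    obtain ⟨a, -, rfl⟩ := Finset.mem_image.1 hb
    refine (Finset.card_le_card (t := {a, a + x}) ?_).trans Finset.card_le_two
    intro c hc
    have h : f (c - a) = 0 := by rw [map_sub, (Finset.mem_filter.1 hc).2, sub_self]
    rcases hker _ h with h | h
    · simp [sub_eq_zero.1 h]
    · simp [← h]
  omega

theorem IsSink.eq_zero_of_mul_eq_zero {R : Type*} [NonUnitalRing R]
    (hcard : ∃ s : Finset R, 5 ≤ s.card) {x : R} (hx : IsSink x) {a : R} (ha : x * a = 0) :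
    a = 0 := by
  obtain ⟨⟨hx0, -⟩, -, hout⟩ := hx
  have hann : ∀ b, x * b = 0 → b = 0 ∨ b = x := by
    intro b hb
    by_contra! h
    exact hout ⟨b, ⟨h.1, Or.inr ⟨x, hx0, hb⟩⟩, h.2, hb⟩
  refine (hann a ha).resolve_right ?_
  rintro rfl
  obtain ⟨s, hs⟩ := hcard
  refine not_five_le_card_of_addMonoidHom (AddMonoidHom.mulLeft a) a hann (fun b => ?_) s hs
  exact hann _ (by simp [← mul_assoc, ha])

theorem IsSource.eq_zero_of_mul_eq_zero {R : Type*} [NonUnitalRing R]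
    (hcard : ∃ s : Finset R, 5 ≤ s.card) {x : R} (hx : IsSource x) {a : R} (ha : a * x = 0) :
    a = 0 := by
  obtain ⟨⟨hx0, -⟩, -, hin⟩ := hx
  have hann : ∀ b, b * x = 0 → b = 0 ∨ b = x := by
    intro b hb
    by_contra! h
    exact hin ⟨b, ⟨h.1, Or.inl ⟨x, hx0, hb⟩⟩, h.2, hb⟩
  refine (hann a ha).resolve_right ?_
  rintro rfl
  obtain ⟨s, hs⟩ := hcard
  refine not_five_le_card_of_addMonoidHom (AddMonoidHom.mulRight a) a hann (fun b => ?_) s hs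
  exact hann _ (by simp [mul_assoc, ha])

theorem IsSink.mul {R : Type*} [NonUnitalRing R]
    (hcard : ∃ s : Finset R, 5 ≤ s.card) {x y : R} (hx : IsSink x) (hy : IsSink y) :
    IsSink (x * y) := by
  have hcancel : ∀ a, x * y * a = 0 → a = 0 := fun a ha =>
    hy.eq_zero_of_mul_eq_zero hcard (hx.eq_zero_of_mul_eq_zero hcard (by rwa [← mul_assoc]))
  have hxy : x * y ≠ 0 := fun h => hy.1.1 (hx.eq_zero_of_mul_eq_zero hcard h)
  obtain ⟨z, hz, -, hzx⟩ := hx.2.1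
  have hzxy : z * (x * y) = 0 := by rw [← mul_assoc, hzx, zero_mul]
  refine ⟨⟨hxy, Or.inr ⟨z, hz.1, hzxy⟩⟩, ⟨z, hz, ?_, hzxy⟩, ?_⟩
  · rintro rfl
    exact hxy (hcancel _ hzxy)
  · rintro ⟨a, ha, -, h⟩
    exact ha.1 (hcancel a h)

theorem IsSink.exists_isSink_mul_eq {R : Type*} [NonUnitalRing R]
    (hcard : ∃ s : Finset R, 5 ≤ s.card) (hfin : {x : R | IsSink x}.Finite)
    {x y : R} (hx : IsSink x) (hy : IsSink y) : ∃ z, IsSink z ∧ x * z = y := by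
  have : Finite {x : R | IsSink x} := hfin
  let f : {x : R | IsSink x} → {x : R | IsSink x} := fun z => ⟨x * z, hx.mul hcard z.2⟩
  have hf : Function.Injective f := by
    intro a b hab
    have h : x * (a : R) = x * b := congrArg Subtype.val hab
    refine Subtype.ext (sub_eq_zero.1 (hx.eq_zero_of_mul_eq_zero hcard ?_))
    rw [mul_sub, h, sub_self]
  obtain ⟨z, hz⟩ := Finite.surjective_of_injective hf ⟨y, hy⟩
  exact ⟨z, z.2, congrArg Subtype.val hz⟩

theorem IsSink.exists_isSink_isLeftId {R : Type*} [NonUnitalRing R]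
    (hcard : ∃ s : Finset R, 5 ≤ s.card) (hfin : {x : R | IsSink x}.Finite)
    {x : R} (hx : IsSink x) : ∃ e : R, IsSink e ∧ IsLeftId e := by
  obtain ⟨e, he, hxe⟩ := hx.exists_isSink_mul_eq hcard hfin hx
  refine ⟨e, he, fun a => sub_eq_zero.1 (hx.eq_zero_of_mul_eq_zero hcard ?_)⟩
  rw [mul_sub, ← mul_assoc, hxe, sub_self]

theorem IsSink.not_isRightId {R : Type*} [NonUnitalRing R] {e : R} (he : IsSink e) :
    ¬ IsRightId e := by
  obtain ⟨y, hy, -, hye⟩ := he.2.1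
  exact fun h => hy.1 ((h y).symm.trans hye)

theorem IsSink.stronglyRightInv {R : Type*} [NonUnitalRing R]
    (hcard : ∃ s : Finset R, 5 ≤ s.card) (hfin : {x : R | IsSink x}.Finite)
    {x : R} (hx : IsSink x) : StronglyRightInv x := by
  obtain ⟨e, he, hid⟩ := hx.exists_isSink_isLeftId hcard hfin
  obtain ⟨t, -, hxt⟩ := hx.exists_isSink_mul_eq hcard hfin he
  refine ⟨⟨e, hid, he.not_isRightId⟩, fun e' _ => ⟨t * e', ?_, fun s hs => ?_⟩⟩
  · simp only [← mul_assoc, hxt, hid e']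
  · refine sub_eq_zero.1 (hx.eq_zero_of_mul_eq_zero hcard ?_)
    simp only at hs
    rw [mul_sub, ← mul_assoc, hxt, hid, hs, sub_self]

theorem stmt18 {R : Type*} [NonUnitalRing R]
    (hcard : ∃ s : Finset R, 5 ≤ s.card)
    (hne : ∃ x : R, IsSink x) (hfin : {x : R | IsSink x}.Finite) :
    (∀ r : R, IsSink r → StronglyRightInv r) ∧ ¬ ∃ x : R, IsSource x := by
  refine ⟨fun r hr => hr.stronglyRightInv hcard hfin, ?_⟩
  rintro ⟨z, hz⟩
  obtain ⟨x, hx⟩ := hne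
  obtain ⟨e, he, hid⟩ := hx.exists_isSink_isLeftId hcard hfin
  obtain ⟨y, hy, -, hye⟩ := he.2.1
  refine hy.1 (hz.eq_zero_of_mul_eq_zero hcard ?_)
  rw [← hid z, ← mul_assoc, hye, zero_mul]
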